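/- arXiv:2212.09369 — 2 statements merged into one kernel-verified Lean document; each statement's English description precedes it below -/
import Mathlib

section
/- Let $a, b, c, d \in \mathbb{C}$ and let $t_1, t_2$ be two distinct nonzero real numbers. If $|a| = |b|$, $|a + t_1 c| = |b + t_1 d|$ and $|a + t_2 c| = |b + t_2 d|$, then $|c| = |d|$ and $\mathrm{Re}(a\overline{c}) = \mathrm{Re}(b\overline{d})$. -/
open Complex ComplexConjugate

theorem sq_norm_add_ofReal_mul (a c : ℂ) (t : ℝ) :
    ‖a + t * c‖ ^ 2 = ‖a‖ ^ 2 + t * (t * ‖c‖ ^ 2 + 2 * (a * conj c).re) := by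
  simp only [Complex.sq_norm, normSq_apply, add_re, add_im, mul_re, mul_im, ofReal_re, ofReal_im,
    conj_re, conj_im]
  ring

theorem phaseless_decouple (a b c d : ℂ) (t₁ t₂ : ℝ)
    (ht₁ : t₁ ≠ 0) (ht₂ : t₂ ≠ 0) (hne : t₁ ≠ t₂)
    (h0 : ‖a‖ = ‖b‖)
    (h1 : ‖a + t₁ * c‖ = ‖b + t₁ * d‖)
    (h2 : ‖a + t₂ * c‖ = ‖b + t₂ * d‖) :
    ‖c‖ = ‖d‖ ∧ (a * conj c).re = (b * conj d).re := by
  have key (t : ℝ) (ht : t ≠ 0) (h : ‖a + t * c‖ = ‖b + t * d‖) :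
      t * ‖c‖ ^ 2 + 2 * (a * conj c).re = t * ‖d‖ ^ 2 + 2 * (b * conj d).re := by
    have hsq := congrArg (· ^ 2) h
    simp only [sq_norm_add_ofReal_mul, h0] at hsq
    exact mul_left_cancel₀ ht (add_left_cancel hsq)
  have e₁ := key t₁ ht₁ h1
  have e₂ := key t₂ ht₂ h2
  have hcd : ‖c‖ ^ 2 = ‖d‖ ^ 2 :=
    mul_left_cancel₀ (sub_ne_zero.mpr hne) (by linear_combination e₁ - e₂)
  refine ⟨(sq_eq_sq₀ (norm_nonneg c) (norm_nonneg d)).mp hcd, ?_⟩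
  linear_combination (e₁ - t₁ * hcd) / 2
end

section
/- Let $a, b, c, d, e, f \in \mathbb{C}$ and let $t_1, t_2$ be two distinct nonzero real numbers. Assume that for $\ell = 1, 2$: $|a| = |b|$, $|a + t_\ell c| = |b + t_\ell d|$, $|a + t_\ell e| = |b + t_\ell f|$, and $|a + t_\ell c + t_\ell e| = |b + t_\ell d + t_\ell f|$. Then $|c| = |d|$, $|e| = |f|$, $|c + e| = |d + f|$, and $\mathrm{Re}(c\overline{e}) = \mathrm{Re}(d\overline{f})$. -/
open Complex ComplexConjugate

/-- If two affine lines in `ℂ` have the same modulus at the parameter `0` and at two further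
distinct nonzero real parameters, then their direction vectors have the same modulus. -/
lemma norm_direction_eq_of_norm_line_eq {a b c d : ℂ} {s t : ℝ} (hs : s ≠ 0) (ht : t ≠ 0)
    (hst : s ≠ t) (h0 : ‖a‖ = ‖b‖) (h1 : ‖a + s * c‖ = ‖b + s * d‖)
    (h2 : ‖a + t * c‖ = ‖b + t * d‖) : ‖c‖ = ‖d‖ := by
  rw [← sq_eq_sq₀ (norm_nonneg _) (norm_nonneg _), Complex.sq_norm, Complex.sq_norm,
    Complex.normSq_apply, Complex.normSq_apply] at h0 h1 h2 ⊢
  simp only [Complex.add_re, Complex.add_im, Complex.re_ofReal_mul,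
    Complex.im_ofReal_mul] at h1 h2
  apply mul_left_cancel₀ (mul_ne_zero (mul_ne_zero hs ht) (sub_ne_zero.mpr hst))
  linear_combination t * h1 - s * h2 + (s - t) * h0

theorem phaseless_decouple_combined (a b c d e f : ℂ) (t₁ t₂ : ℝ)
    (ht₁ : t₁ ≠ 0) (ht₂ : t₂ ≠ 0) (hne : t₁ ≠ t₂)
    (h0 : ‖a‖ = ‖b‖)
    (h1 : ∀ ℓ ∈ ({t₁, t₂} : Set ℝ),
      ‖a + ℓ * c‖ = ‖b + ℓ * d‖)
    (h2 : ∀ ℓ ∈ ({t₁, t₂} : Set ℝ),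
      ‖a + ℓ * e‖ = ‖b + ℓ * f‖)
    (h3 : ∀ ℓ ∈ ({t₁, t₂} : Set ℝ),
      ‖a + ℓ * c + ℓ * e‖ = ‖b + ℓ * d + ℓ * f‖) :
    ‖c‖ = ‖d‖ ∧ ‖e‖ = ‖f‖ ∧
      ‖c + e‖ = ‖d + f‖ ∧
      (c * conj e).re = (d * conj f).re := by
  have hc : ‖c‖ = ‖d‖ :=
    norm_direction_eq_of_norm_line_eq ht₁ ht₂ hne h0 (h1 t₁ (by simp)) (h1 t₂ (by simp))
  have he : ‖e‖ = ‖f‖ :=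
    norm_direction_eq_of_norm_line_eq ht₁ ht₂ hne h0 (h2 t₁ (by simp)) (h2 t₂ (by simp))
  have hce : ‖c + e‖ = ‖d + f‖ := by
    refine norm_direction_eq_of_norm_line_eq ht₁ ht₂ hne h0 ?_ ?_
    · simpa only [mul_add, add_assoc] using h3 t₁ (by simp)
    · simpa only [mul_add, add_assoc] using h3 t₂ (by simp)
  refine ⟨hc, he, hce, ?_⟩
  have key : ∀ z w : ℂ, ‖z + w‖ ^ 2 = ‖z‖ ^ 2 + ‖w‖ ^ 2 + 2 * (z * conj w).re := fun z w => by
    simp only [Complex.sq_norm, Complex.normSq_add]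
  have h := key c e
  rw [hce, hc, he, key d f] at h
  linarith
end
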